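/- Let R be an Abelian exchange ring and G a locally finite group. Then the group ring RG has stable range one: for all a, b ∈ RG with a·RG + b·RG = RG, there exists x ∈ RG such that a + b·x is a unit of RG. -/

import Mathlib

def HasSR1 (A : Type*) [Ring A] : Prop :=
  ∀ a b : A, (∃ x y : A, a * x + b * y = 1) → ∃ x : A, IsUnit (a + b * x)

theorem semisimple_regular {A : Type*} [Ring A] [IsSemisimpleRing A] (a : A) :
    ∃ u, a * u * a = a := by
  obtain ⟨C, hC⟩ := exists_isCompl (Ideal.span {a})
  have h1 : (1 : A) ∈ Ideal.span {a} ⊔ C := by rw [hC.sup_eq_top]; trivial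
  obtain ⟨y, hy, c, hc, hyc⟩ := Submodule.mem_sup.1 h1
  obtain ⟨r, rfl⟩ := Ideal.mem_span_singleton'.1 hy
  refine ⟨r, ?_⟩
  have h2 : a * c = a - a * r * a := by
    have : a * (r * a + c) = a := by rw [hyc, mul_one]
    rw [mul_add, ← mul_assoc] at this
    exact eq_sub_of_add_eq' this
  have h3 : a * c ∈ Ideal.span {a} := by
    rw [h2]
    exact Submodule.sub_mem _ (Ideal.mem_span_singleton_self a)
      (Ideal.mem_span_singleton'.2 ⟨a * r, rfl⟩)
  have h4 : a * c ∈ Ideal.span {a} ⊓ C := ⟨h3, C.mul_mem_left a hc⟩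
  rw [hC.inf_eq_bot] at h4
  have h5 : a * c = 0 := by simpa using h4
  rw [h5] at h2
  exact (sub_eq_zero.1 h2.symm).symm

theorem semisimple_left {A : Type*} [Ring A] [IsSemisimpleRing A] (a0 b : A)
    (h0 : ∃ x y : A, x * a0 + y * b = 1) : ∃ x : A, IsUnit (a0 + x * b) := by
  obtain ⟨I, ⟨x0, rfl⟩, hmax⟩ := (wellFounded_gt (α := Ideal A)).has_min
    (Set.range fun x : A => Ideal.span {a0 + x * b}) ⟨_, 0, rfl⟩
  refine ⟨x0, ?_⟩
  set a := a0 + x0 * b with ha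
  obtain ⟨p, q, hpq⟩ := h0
  have hpq' : p * a + (q - p * x0) * b = 1 := by
    rw [← hpq, ha]; noncomm_ring
  obtain ⟨u, hu⟩ := semisimple_regular a
  -- it suffices that `b ∈ A a`
  by_cases hd : b * (1 - u * a) = 0
  · have hb : b = b * u * a := by
      rw [mul_sub, mul_one, sub_eq_zero] at hd
      rw [mul_assoc]; exact hd
    have hinv : (p + (q - p * x0) * (b * u)) * a = 1 := by
      rw [← hpq']
      conv_rhs => rw [hb]
      noncomm_ring
    set v := p + (q - p * x0) * (b * u)
    have hs : Function.Surjective (LinearMap.toSpanSingleton A A a) := fun r =>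
      ⟨r * v, by simp [mul_assoc, hinv]⟩
    have hi := IsNoetherian.injective_of_surjective_endomorphism _ hs
    have : a * v = 1 := by
      apply hi
      simp [mul_assoc, hinv]
    exact ⟨⟨a, v, this, hinv⟩, rfl⟩
  exfalso
  have hz : ∀ w, (1 - a * u) * w * (b * (1 - u * a)) = 0 := by
    intro w
    have hle : Ideal.span {a} ≤ Ideal.span {a0 + (x0 + (1 - a * u) * w) * b} := by
      rw [Ideal.span_singleton_le_iff_mem, Ideal.mem_span_singleton']
      refine ⟨a * u, ?_⟩
      have e1 : a0 + (x0 + (1 - a * u) * w) * b = a + (1 - a * u) * w * b := by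
        rw [ha]; noncomm_ring
      rw [e1, mul_add, hu]
      have e2 : a * u * ((1 - a * u) * w * b) = (a * u - a * u * a * u) * w * b := by noncomm_ring
      rw [e2, hu]; simp
    have hnot := hmax _ ⟨x0 + (1 - a * u) * w, rfl⟩
    have heq : Ideal.span {a} = Ideal.span {a0 + (x0 + (1 - a * u) * w) * b} := by
      by_contra hne
      exact hnot (lt_of_le_of_ne hle hne)
    have hm : a0 + (x0 + (1 - a * u) * w) * b ∈ Ideal.span {a} := by
      rw [heq]; exact Ideal.mem_span_singleton_self _
    obtain ⟨r, hr⟩ := Ideal.mem_span_singleton'.1 hm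
    have e1 : (1 - a * u) * w * b = (r - 1) * a := by
      rw [sub_mul r 1 a, hr, ha]; noncomm_ring
    rw [← mul_assoc, e1]
    have : (r - 1) * a * (1 - u * a) = (r - 1) * (a - a * u * a) := by noncomm_ring
    rw [this, hu]; simp
  let I : Ideal A :=
    { carrier := {z | ∀ w, (1 - a * u) * w * z = 0}
      add_mem' := fun {x y} hx hy w => by rw [mul_add, hx w, hy w, add_zero]
      zero_mem' := fun w => by simp
      smul_mem' := fun c x hx w => by
        have := hx (w * c)
        simpa [mul_assoc] using this }
  have hIr : ∀ z ∈ I, z * a ∈ I := fun z hz w => by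
    have := hz w
    rw [← mul_assoc, this, zero_mul]
  let φ : I →ₗ[A] I := (LinearMap.toSpanSingleton A A a).restrict (p := I) (q := I)
    (fun z hz => by simpa using hIr z hz)
  have hφ : ∀ z : I, ((φ z : I) : A) = z * a := fun z => by simp [φ]
  have hinj : Function.Injective φ := by
    rw [injective_iff_map_eq_zero]
    rintro ⟨z, hzI⟩ h
    have h1 : z * a = 0 := by
      have := congrArg (fun t : I => (t : A)) h
      simpa [hφ] using this
    obtain ⟨w, hw⟩ := semisimple_regular z
    have h2 : (1 - a * u) * w * z = 0 := hzI w
    have h3 : z * (1 - a * u) = z := by rw [mul_sub, ← mul_assoc, h1]; simp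
    have h4 : z = 0 := by
      rw [← hw]
      nth_rw 1 [← h3]
      rw [mul_assoc, mul_assoc, ← mul_assoc (1 - a * u), h2, mul_zero]
    exact Subtype.ext h4
  obtain ⟨t, ht⟩ := IsArtinian.surjective_of_injective_endomorphism φ hinj
    ⟨b * (1 - u * a), hz⟩
  have ht' : (t : A) * a = b * (1 - u * a) := by
    rw [← hφ, ht]
  apply hd
  have e1 : b * (1 - u * a) * (1 - u * a) = b * (1 - u * a) := by
    have : b * (1 - u * a) * (1 - u * a) = b * (1 - u * a - u * a + u * (a * u * a)) := by
      noncomm_ring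
    rw [this, hu]; noncomm_ring
  rw [← e1, ← ht']
  have : (t : A) * a * (1 - u * a) = t * (a - a * u * a) := by noncomm_ring
  rw [this, hu]; simp

theorem semisimple_sr1 (A : Type*) [Ring A] [IsSemisimpleRing A] : HasSR1 A := by
  rintro a b ⟨x, y, h⟩
  obtain ⟨z, hz⟩ := semisimple_left (MulOpposite.op a) (MulOpposite.op b)
    ⟨MulOpposite.op x, MulOpposite.op y, by
      rw [← MulOpposite.op_mul, ← MulOpposite.op_mul, ← MulOpposite.op_add, h]; rfl⟩
  refine ⟨z.unop, ?_⟩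
  have := hz.unop
  simpa using this

theorem sr1_lift {A B : Type*} [Ring A] [Ring B] (f : A →+* B) (hf : Function.Surjective f)
    (hk : ∀ k, f k = 0 → ∃ t, t * (1 - k) = 1) (hB : HasSR1 B) : HasSR1 A := by
  have hk' : ∀ k, f k = 0 → IsUnit (1 - k) := by
    intro k h
    obtain ⟨t, ht⟩ := hk k h
    have ht1 : t = 1 - (-(t * k)) := by
      rw [← ht]; noncomm_ring
    obtain ⟨s, hs⟩ := hk (-(t * k)) (by simp [h])
    rw [← ht1] at hs
    have : s = 1 - k := by
      calc s = s * (t * (1 - k)) := by rw [ht, mul_one]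
        _ = _ := by rw [← mul_assoc, hs, one_mul]
    rw [this] at hs
    exact ⟨⟨1 - k, t, hs, ht⟩, rfl⟩
  have hu : ∀ a, IsUnit (f a) → IsUnit a := by
    intro a ha
    obtain ⟨v, hv1, hv2⟩ := isUnit_iff_exists.1 ha
    obtain ⟨v, rfl⟩ := hf v
    have h1 := hk' (1 - a * v) (by simp [hv1])
    have h2 := hk' (1 - v * a) (by simp [hv2])
    rw [sub_sub_cancel] at h1 h2
    obtain ⟨p, hp, -⟩ := isUnit_iff_exists.1 h1
    obtain ⟨q, -, hq⟩ := isUnit_iff_exists.1 h2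
    rw [mul_assoc] at hp
    rw [← mul_assoc] at hq
    have : q * v = v * p := by
      calc q * v = q * v * (a * (v * p)) := by rw [hp, mul_one]
        _ = _ := by rw [← mul_assoc, hq, one_mul]
    rw [this] at hq
    exact ⟨⟨a, v * p, hp, hq⟩, rfl⟩
  rintro a b ⟨x, y, h⟩
  obtain ⟨z, hz⟩ := hB (f a) (f b) ⟨f x, f y, by rw [← map_mul, ← map_mul, ← map_add, h, map_one]⟩
  obtain ⟨z, rfl⟩ := hf z
  exact ⟨z, hu _ (by simpa using hz)⟩

theorem artinian_sr1 (A : Type*) [Ring A] [IsArtinianRing A] : HasSR1 A := by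
  refine sr1_lift (Ideal.Quotient.mk (Ring.jacobson A)) Ideal.Quotient.mk_surjective ?_
    (semisimple_sr1 _)
  intro k hk
  rw [Ideal.Quotient.eq_zero_iff_mem] at hk
  obtain ⟨n, hn⟩ := IsSemiprimaryRing.isNilpotent (R := A)
  have : IsNilpotent k := ⟨n, by
    have := Ideal.pow_mem_pow hk n
    rw [hn] at this
    simpa using this⟩
  obtain ⟨t, -, ht⟩ := isUnit_iff_exists.1 this.isUnit_one_sub
  exact ⟨t, ht⟩

theorem local_sr1 {L : Type*} [Ring L] [Nontrivial L] (hL : ∀ a : L, IsUnit a ∨ IsUnit (1 - a))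
    (G : Type*) [Group G] [Finite G] : HasSR1 (MonoidAlgebra L G) := by
  classical
  cases nonempty_fintype G
  set J := Ring.jacobson L with hJ
  have hmemJ : ∀ z : L, IsUnit z ∨ z ∈ J := by
    intro z
    by_contra! hcon
    obtain ⟨hzu, hzJ⟩ := hcon
    rw [hJ, Ring.jacobson_eq_sInf_isMaximal, Submodule.mem_sInf] at hzJ
    push Not at hzJ
    obtain ⟨m, hm, hzm⟩ := hzJ
    have hm' : Ideal.IsMaximal m := hm
    obtain ⟨w, y, hy, h1⟩ := hm'.exists_inv hzm
    have hy' : ¬ IsUnit y := fun h => hm'.ne_top (Ideal.eq_top_of_isUnit_mem _ hy h)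
    have h2 : IsUnit (w * z) := by
      rcases hL y with h | h
      · exact absurd h hy'
      · rwa [← h1, add_sub_cancel_right] at h
    obtain ⟨v, -, hv⟩ := isUnit_iff_exists.1 h2
    rw [← mul_assoc] at hv
    set s := v * w
    -- `s * z = 1`, so `z * s` is idempotent
    have hid : z * s * (1 - z * s) = 0 := by
      have : z * s * (1 - z * s) = z * s - z * (s * z) * s := by noncomm_ring
      rw [this, hv]; simp
    rcases hL (z * s) with h | h
    · have := h.mul_right_eq_zero.1 hid
      exact hzu ⟨⟨z, s, (sub_eq_zero.1 this).symm, hv⟩, rfl⟩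
    · have h0 := h.mul_left_eq_zero.1 hid
      have : (1 : L) = 0 := by
        calc (1 : L) = (s * z) * (s * z) := by rw [hv, mul_one]
          _ = s * (z * s) * z := by noncomm_ring
          _ = 0 := by rw [h0]; simp
      exact one_ne_zero this
  have : Nontrivial (L ⧸ J) := Ideal.Quotient.nontrivial_iff.2 (Ring.jacobson_lt_top L).ne
  let : DivisionRing (L ⧸ J) := DivisionRing.ofIsUnitOrEqZero (by
    intro d
    obtain ⟨z, rfl⟩ := Ideal.Quotient.mk_surjective d
    rcases hmemJ z with h | h
    · exact Or.inl (h.map _)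
    · exact Or.inr (Ideal.Quotient.eq_zero_iff_mem.2 h))
  have : Module.Finite (L ⧸ J) (MonoidAlgebra (L ⧸ J) G) :=
    Module.Finite.of_basis (MonoidAlgebra.basis G (L ⧸ J))
  have : Module.Finite L (MonoidAlgebra L G) :=
    Module.Finite.of_basis (MonoidAlgebra.basis G L)
  have : IsArtinianRing (MonoidAlgebra (L ⧸ J) G) :=
    isArtinian_of_tower (L ⧸ J) inferInstance
  refine sr1_lift (MonoidAlgebra.mapRingHom G (Ideal.Quotient.mk J))
    (MonoidAlgebra.map_surjective _ Ideal.Quotient.mk_surjective) ?_ (artinian_sr1 _)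
  intro k hk
  have hker : ∀ z : MonoidAlgebra L G, MonoidAlgebra.mapRingHom G (Ideal.Quotient.mk J) z = 0 →
      z ∈ J • (⊤ : Submodule L (MonoidAlgebra L G)) := by
    intro z hz
    rw [← MonoidAlgebra.sum_coeff_single z]
    refine Submodule.sum_mem _ fun g _ => ?_
    have : MonoidAlgebra.single g (z.coeff g) = z.coeff g • MonoidAlgebra.single g (1 : L) := by
      simp
    simp only [this]
    refine Submodule.smul_mem_smul ?_ trivial
    rw [← Ideal.Quotient.eq_zero_iff_mem, ← MonoidAlgebra.coeff_mapRingHom, hz]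
    simp
  let N : Submodule L (MonoidAlgebra L G) :=
    { carrier := {z | ∃ t, t * (1 - k) = z}
      add_mem' := by
        rintro _ _ ⟨s, rfl⟩ ⟨t, rfl⟩
        exact ⟨s + t, add_mul _ _ _⟩
      zero_mem' := ⟨0, zero_mul _⟩
      smul_mem' := by
        rintro c _ ⟨t, rfl⟩
        exact ⟨c • t, smul_mul_assoc _ _ _⟩ }
  suffices h : (1 : MonoidAlgebra L G) ∈ N from h
  have htop : N = ⊤ := by
    by_contra hne
    obtain ⟨m, hm, hNm⟩ := (eq_top_or_exists_le_coatom N).resolve_left hne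
    have h1 : J • (⊤ : Submodule L (MonoidAlgebra L G)) ≤ m :=
      (Ring.jacobson_smul_top_le L _).trans (sInf_le hm)
    apply hm.1
    rw [eq_top_iff]
    intro t _
    have e : t = t * (1 - k) + t * k := by noncomm_ring
    rw [e]
    exact m.add_mem (hNm ⟨t, rfl⟩) (h1 (hker _ (by rw [map_mul, hk, mul_zero])))
  rw [htop]; trivial

section join
variable {A : Type*} [Ring A]

theorem good_join (a b E F : A) (hE : ∀ z, E * z = z * E) (hF : ∀ z, F * z = z * F)
    (hEE : E * E = E)
    (h1 : ∃ x y, E * ((a + b * x) * y) = E ∧ E * (y * (a + b * x)) = E)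
    (h2 : ∃ x y, F * ((a + b * x) * y) = F ∧ F * (y * (a + b * x)) = F) :
    ∃ x y, (E + F - E * F) * ((a + b * x) * y) = E + F - E * F ∧
      (E + F - E * F) * (y * (a + b * x)) = E + F - E * F := by
  obtain ⟨x1, y1, h1, h1'⟩ := h1
  obtain ⟨x2, y2, h2, h2'⟩ := h2
  have key : ∀ p q : A, ∃ r, r = E * p + (1 - E) * q ∧ E * r = E * p ∧ (1 - E) * r = (1 - E) * q := by
    intro p q
    refine ⟨_, rfl, ?_, ?_⟩
    · have : E * (E * p + (1 - E) * q) = (E * E) * p + (E - E * E) * q := by noncomm_ring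
      rw [this, hEE]; simp
    · have : (1 - E) * (E * p + (1 - E) * q) =
        (E - E * E) * p + (1 - E - E + E * E) * q := by noncomm_ring
      rw [this, hEE]; simp
  obtain ⟨x, -, hx1, hx2⟩ := key x1 x2
  obtain ⟨y, -, hy1, hy2⟩ := key y1 y2
  have hE' : ∀ z, (1 - E) * z = z * (1 - E) := fun z => by
    rw [sub_mul, mul_sub, hE]; simp
  -- a central element transports the two products
  have tr : ∀ C x x₁ y y₁ : A, (∀ z, C * z = z * C) → C * x = C * x₁ → C * y = C * y₁ →
      C * ((a + b * x) * y) = C * ((a + b * x₁) * y₁) ∧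
      C * (y * (a + b * x)) = C * (y₁ * (a + b * x₁)) := by
    intro C x x₁ y y₁ hC hx hy
    have hb : C * (a + b * x) = C * (a + b * x₁) := by
      rw [mul_add, mul_add, ← mul_assoc, ← mul_assoc, hC b, mul_assoc, hx, mul_assoc]
    constructor
    · rw [← mul_assoc, hb, hC, mul_assoc, hy, ← mul_assoc, ← hC, mul_assoc]
    · rw [← mul_assoc, hy, hC, mul_assoc, hb, ← mul_assoc, ← hC, mul_assoc]
  obtain ⟨t1, t1'⟩ := tr E x x1 y y1 hE hx1 hy1
  obtain ⟨t2, t2'⟩ := tr (1 - E) x x2 y y2 hE' hx2 hy2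
  have dec : ∀ z z2 : A, E * z = E → (1 - E) * z = (1 - E) * z2 → F * z2 = F →
      (E + F - E * F) * z = E + F - E * F := by
    intro z z2 u1 u2 u3
    have : (E + F - E * F) * z = E * z + F * z - E * F * z := by noncomm_ring
    have h3 : F * ((1 - E) * z) = F * z - E * F * z := by
      rw [hE F]; noncomm_ring
    have h4 : F * ((1 - E) * z) = F - E * F := by
      rw [u2, ← mul_assoc, hF, mul_assoc, u3, sub_mul, one_mul]
    rw [this, u1, add_sub_assoc, ← h3, h4, add_sub_assoc]
  exact ⟨x, y, dec _ _ (t1.trans h1) t2 h2, dec _ _ (t1'.trans h1') t2' h2'⟩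

end join

theorem finite_sr1 {R : Type*} [Ring R] {G : Type*} [Group G] [Finite G]
    (habelian : ∀ e : R, IsIdempotentElem e → ∀ r : R, e * r = r * e)
    (hexchange : ∀ a : R, ∃ e : R, IsIdempotentElem e ∧
      (∃ r : R, e = a * r) ∧ (∃ s : R, 1 - e = (1 - a) * s)) :
    HasSR1 (MonoidAlgebra R G) := by
  classical
  cases nonempty_fintype G
  rintro a b hab
  let T : R → MonoidAlgebra R G := fun e => MonoidAlgebra.single 1 e
  have hTc : ∀ e, IsIdempotentElem e → ∀ z, T e * z = z * T e := fun e he z =>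
    MonoidAlgebra.single_commute (fun g => Commute.one_left g) (fun r => habelian e he r) z
  have hTm : ∀ e f, T (e * f) = T e * T f := fun e f => by
    simp [T, MonoidAlgebra.single_mul_single]
  have hTa : ∀ e f, T (e + f) = T e + T f := fun e f => by
    simp [T, MonoidAlgebra.single_add]
  have hTs : ∀ e f, T (e - f) = T e - T f := fun e f => by
    rw [eq_sub_iff_add_eq, ← hTa, sub_add_cancel]
  have hT1 : T 1 = 1 := rfl
  let S : R → Prop := fun e => IsIdempotentElem e ∧
    ∃ x y, T e * ((a + b * x) * y) = T e ∧ T e * (y * (a + b * x)) = T e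
  have idem_join : ∀ e f : R, IsIdempotentElem e → IsIdempotentElem f →
      IsIdempotentElem (e + f - e * f) := by
    intro e f he hf
    exact he.add_sub_mul_of_commute (habelian e he f) hf
  have hSj : ∀ e f, S e → S f → S (e + f - e * f) := by
    rintro e f ⟨he, h1⟩ ⟨hf, h2⟩
    refine ⟨idem_join e f he hf, ?_⟩
    have := good_join a b (T e) (T f) (hTc e he) (hTc f hf) (by rw [← hTm, he.eq]) h1 h2
    rw [hTs, hTa, hTm]
    exact this
  by_cases hS1 : S 1
  · obtain ⟨-, x, y, h1, h2⟩ := hS1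
    rw [hT1, one_mul] at h1 h2
    exact ⟨x, ⟨⟨a + b * x, y, h1, h2⟩, rfl⟩⟩
  exfalso
  have habs : ∀ r e f : R, IsIdempotentElem e → r * e = r → r * (e + f - e * f) = r := by
    intro r e f he h
    rw [mul_sub, mul_add, ← mul_assoc, h]; simp
  have habs' : ∀ r e f : R, IsIdempotentElem e → r * f = r → r * (e + f - e * f) = r := by
    intro r e f he h
    rw [habelian e he f, mul_sub, mul_add, ← mul_assoc, h]; simp
  let I0 : Ideal (Subring.center R) :=
    { carrier := {z | ∃ e, S e ∧ (z : R) * e = z}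
      add_mem' := by
        rintro z w ⟨e, he, h1⟩ ⟨f, hf, h2⟩
        refine ⟨e + f - e * f, hSj e f he hf, ?_⟩
        simp only [Subring.coe_add]
        rw [add_mul, habs _ e f he.1 h1, habs' _ e f he.1 h2]
      zero_mem' := ⟨0, ⟨by simp [IsIdempotentElem], 0, 0, by simp [T], by simp [T]⟩, by simp⟩
      smul_mem' := by
        rintro c z ⟨e, he, h1⟩
        refine ⟨e, he, ?_⟩
        simp only [smul_eq_mul, Subring.coe_mul]
        rw [mul_assoc, h1] }
  have hI0 : I0 ≠ ⊤ := by
    rw [Ideal.ne_top_iff_one]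
    rintro ⟨e, he, h1⟩
    have : e = 1 := by simpa using h1
    exact hS1 (this ▸ he)
  obtain ⟨M, hM, hIM⟩ := Ideal.exists_le_maximal I0 hI0
  have hMp := hM.isPrime
  have hcen : ∀ e, IsIdempotentElem e → e ∈ Subring.center R := fun e he =>
    Subring.mem_center_iff.2 fun g => (habelian e he g).symm
  -- idempotents in `M`
  let P : R → Prop := fun e => IsIdempotentElem e ∧ ∃ h : e ∈ Subring.center R, (⟨e, h⟩ : Subring.center R) ∈ M
  have hPS : ∀ e, S e → P e := fun e he =>
    ⟨he.1, hcen e he.1, hIM ⟨e, he, he.1.eq⟩⟩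
  have hPj : ∀ e f, P e → P f → P (e + f - e * f) := by
    rintro e f ⟨he, he', h1⟩ ⟨hf, hf', h2⟩
    refine ⟨idem_join e f he hf, hcen _ (idem_join e f he hf), ?_⟩
    exact M.sub_mem (M.add_mem h1 h2) (M.mul_mem_left ⟨e, he'⟩ h2)
  have hPc : ∀ e, IsIdempotentElem e → P e ∨ P (1 - e) := by
    intro e he
    have h0 : (⟨e, hcen e he⟩ : Subring.center R) * ⟨1 - e, hcen _ he.one_sub⟩ ∈ M := by
      convert M.zero_mem
      ext
      simp [mul_sub, he.eq]
    rcases hMp.mem_or_mem h0 with h | h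
    · exact Or.inl ⟨he, _, h⟩
    · exact Or.inr ⟨he.one_sub, _, h⟩
  have hP1 : ∀ e, P e → ¬ P (1 - e) := by
    rintro e ⟨he, he', h1⟩ ⟨hf, hf', h2⟩
    apply (Ideal.ne_top_iff_one M).1 hM.ne_top
    have := M.add_mem h1 h2
    convert this
    ext; simp
  have hP0 : P 0 := ⟨by simp [IsIdempotentElem], hcen 0 (by simp [IsIdempotentElem]), M.zero_mem⟩
  let I : Ideal R :=
    { carrier := {r | ∃ e, P e ∧ r * e = r}
      add_mem' := by
        rintro z w ⟨e, he, h1⟩ ⟨f, hf, h2⟩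
        refine ⟨e + f - e * f, hPj e f he hf, ?_⟩
        rw [add_mul, habs _ e f he.1 h1, habs' _ e f he.1 h2]
      zero_mem' := ⟨0, hP0, by simp⟩
      smul_mem' := by
        rintro c z ⟨e, he, h1⟩
        refine ⟨e, he, ?_⟩
        simp only [smul_eq_mul]
        rw [mul_assoc, h1] }
  have hI2 : I.IsTwoSided := ⟨by
    rintro z c ⟨e, he, h1⟩
    refine ⟨e, he, ?_⟩
    rw [mul_assoc, ← habelian e he.1, ← mul_assoc, h1]⟩
  have hPI : ∀ e, P e → e ∈ I := fun e he => ⟨e, he, he.1.eq⟩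
  have hnt : Nontrivial (R ⧸ I) := by
    rw [Ideal.Quotient.nontrivial_iff, Ideal.ne_top_iff_one]
    rintro ⟨e, he, h1⟩
    rw [one_mul] at h1
    subst h1
    exact hP1 _ he (by simpa using hP0)
  -- one-sided version
  have hright : ∀ d : R ⧸ I, (∃ v, d * v = 1) ∨ ∃ v, (1 - d) * v = 1 := by
    intro d
    obtain ⟨r, rfl⟩ := Ideal.Quotient.mk_surjective d
    obtain ⟨e, he, ⟨p, hp⟩, ⟨q, hq⟩⟩ := hexchange r
    rcases hPc e he with h | h
    · right
      refine ⟨Ideal.Quotient.mk I q, ?_⟩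
      have h0 : Ideal.Quotient.mk I e = 0 := Ideal.Quotient.eq_zero_iff_mem.2 (hPI e h)
      rw [← map_one (Ideal.Quotient.mk I), ← map_sub, ← map_mul, ← hq, map_sub, h0, sub_zero]
    · left
      refine ⟨Ideal.Quotient.mk I p, ?_⟩
      have h0 : Ideal.Quotient.mk I (1 - e) = 0 := Ideal.Quotient.eq_zero_iff_mem.2 (hPI _ h)
      rw [map_sub, sub_eq_zero, map_one] at h0
      rw [← map_mul, ← hp, h0]
  have hun : ∀ d v : R ⧸ I, d * v = 1 → IsUnit d := by
    intro d v hdv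
    have hid : v * d * (v * d) = v * d := by
      rw [mul_assoc, ← mul_assoc d, hdv, one_mul]
    rcases hright (v * d) with ⟨w, hw⟩ | ⟨w, hw⟩
    · have : v * d = 1 := by
        calc v * d = v * d * (v * d * w) := by rw [hw, mul_one]
          _ = 1 := by rw [← mul_assoc, hid, hw]
      exact ⟨⟨d, v, hdv, this⟩, rfl⟩
    · exfalso
      have h0 : v * d = 0 := by
        calc v * d = v * d * ((1 - v * d) * w) := by rw [hw, mul_one]
          _ = 0 := by rw [← mul_assoc, mul_sub, hid, mul_one, sub_self, zero_mul]
      have : (1 : R ⧸ I) = 0 := by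
        calc (1 : R ⧸ I) = d * v * (d * v) := by rw [hdv, mul_one]
          _ = d * (v * d) * v := by noncomm_ring
          _ = 0 := by rw [h0]; simp
      exact one_ne_zero this
  have hloc : ∀ d : R ⧸ I, IsUnit d ∨ IsUnit (1 - d) := fun d =>
    (hright d).imp (fun ⟨v, hv⟩ => hun _ v hv) (fun ⟨v, hv⟩ => hun _ v hv)
  let π := MonoidAlgebra.mapRingHom G (Ideal.Quotient.mk I)
  have hπ : Function.Surjective π := MonoidAlgebra.map_surjective _ Ideal.Quotient.mk_surjective
  obtain ⟨p, q, hpq⟩ := hab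
  obtain ⟨x, hx⟩ := local_sr1 hloc G (π a) (π b)
    ⟨π p, π q, by rw [← map_mul, ← map_mul, ← map_add, hpq, map_one]⟩
  obtain ⟨x, rfl⟩ := hπ x
  obtain ⟨y, hy1, hy2⟩ := isUnit_iff_exists.1 hx
  obtain ⟨y, rfl⟩ := hπ y
  have hker : ∀ c, π c = 0 → ∃ e, P e ∧ c * T e = c := by
    intro c hc
    have h1 : ∀ g, c.coeff g ∈ I := fun g => by
      rw [← Ideal.Quotient.eq_zero_iff_mem, ← MonoidAlgebra.coeff_mapRingHom]
      change (π c).coeff g = 0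
      rw [hc]; simp
    have h2 : ∀ s : Finset G, ∃ e, P e ∧ ∀ g ∈ s, c.coeff g * e = c.coeff g := by
      intro s
      induction s using Finset.induction_on with
      | empty => exact ⟨0, hP0, by simp⟩
      | insert g s _ ih =>
        obtain ⟨e, he, h⟩ := ih
        obtain ⟨f, hf, h'⟩ := h1 g
        refine ⟨e + f - e * f, hPj e f he hf, ?_⟩
        intro k hk
        rcases Finset.mem_insert.1 hk with rfl | hk
        · exact habs' _ _ _ he.1 h'
        · exact habs _ _ _ he.1 (h k hk)
    obtain ⟨e, he, h⟩ := h2 Finset.univ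
    refine ⟨e, he, ?_⟩
    ext g
    have : (c * T e).coeff g = c.coeff g * e := by
      simp [T]
    rw [this, h g (Finset.mem_univ g)]
  obtain ⟨e, he, h1⟩ := hker ((a + b * x) * y - 1) (by simpa [sub_eq_zero] using hy1)
  obtain ⟨f, hf, h2⟩ := hker (y * (a + b * x) - 1) (by simpa [sub_eq_zero] using hy2)
  have hj := hPj e f he hf
  refine hP1 _ hj (hPS _ ⟨hj.1.one_sub, x, y, ?_, ?_⟩)
  · rw [← sub_eq_zero]
    have e1 : T (1 - (e + f - e * f)) * ((a + b * x) * y) - T (1 - (e + f - e * f)) =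
      T (1 - (e + f - e * f)) * ((a + b * x) * y - 1) := by noncomm_ring
    rw [e1, hTc _ hj.1.one_sub, hTs, hTs, hTa, hTm, hT1]
    generalize (a + b * x) * y - 1 = c at h1
    have : c * (1 - (T e + T f - T e * T f)) = c - c * T e - c * T f + c * T e * T f := by
      noncomm_ring
    rw [this, h1]; noncomm_ring
  · rw [← sub_eq_zero]
    have e1 : T (1 - (e + f - e * f)) * (y * (a + b * x)) - T (1 - (e + f - e * f)) =
      T (1 - (e + f - e * f)) * (y * (a + b * x) - 1) := by noncomm_ring
    rw [e1, hTc _ hj.1.one_sub, hTs, hTs, hTa, hTm, hT1, hTc e he.1]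
    generalize y * (a + b * x) - 1 = c at h2
    have : c * (1 - (T e + T f - T f * T e)) = c - c * T e - c * T f + c * T f * T e := by
      noncomm_ring
    rw [this, h2]; noncomm_ring

/-- If `R` is an Abelian exchange ring and `G` is a locally finite group, then the group
ring `RG` has stable range one: whenever `a·RG + b·RG = RG` there is `x` with `a + b·x`
a unit. -/
theorem monoidAlgebra_stable_range_one {R : Type*} [Ring R] {G : Type*} [Group G]
    (habelian : ∀ e : R, IsIdempotentElem e → ∀ r : R, e * r = r * e)
    (hexchange : ∀ a : R, ∃ e : R, IsIdempotentElem e ∧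
      (∃ r : R, e = a * r) ∧ (∃ s : R, 1 - e = (1 - a) * s))
    (hLF : ∀ s : Finset G, Finite (Subgroup.closure (s : Set G))) :
    ∀ a b : MonoidAlgebra R G, (∃ x y : MonoidAlgebra R G, a * x + b * y = 1) →
      ∃ x : MonoidAlgebra R G, IsUnit (a + b * x) := by
  classical
  rintro a b ⟨x, y, h⟩
  let s : Finset G := (a.coeff.support ∪ b.coeff.support) ∪ (x.coeff.support ∪ y.coeff.support)
  have hfin := hLF s
  set H := Subgroup.closure (s : Set G) with hH
  let ι := MonoidAlgebra.mapDomainRingHom R H.subtype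
  have hι : Function.Injective ι := MonoidAlgebra.mapDomain_injective H.subtype_injective
  have hr : ∀ c : MonoidAlgebra R G, c.coeff.support ⊆ s → ∃ c₁, ι c₁ = c := by
    intro c hc
    refine ⟨MonoidAlgebra.comapDomain H.subtype H.subtype_injective c, ?_⟩
    apply MonoidAlgebra.mapDomain_comapDomain
    intro g hg
    exact ⟨⟨g, Subgroup.subset_closure (hc hg)⟩, rfl⟩
  obtain ⟨a₁, ha⟩ := hr a (by intro g hg; simp only [s, Finset.mem_union]; tauto)
  obtain ⟨b₁, hb⟩ := hr b (by intro g hg; simp only [s, Finset.mem_union]; tauto)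
  obtain ⟨x₁, hx⟩ := hr x (by intro g hg; simp only [s, Finset.mem_union]; tauto)
  obtain ⟨y₁, hy⟩ := hr y (by intro g hg; simp only [s, Finset.mem_union]; tauto)
  have h' : a₁ * x₁ + b₁ * y₁ = 1 :=
    hι (by rw [map_add, map_mul, map_mul, ha, hb, hx, hy, h, map_one])
  obtain ⟨z, hz⟩ := finite_sr1 habelian hexchange a₁ b₁ ⟨x₁, y₁, h'⟩
  refine ⟨ι z, ?_⟩
  rw [← ha, ← hb, ← map_mul, ← map_add]
  exact hz.map ι
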